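/- arXiv:1508.05432 — 3 statements merged into one kernel-verified Lean document; each statement's English description precedes it below -/
import Mathlib

section
/- Let β > 0, k ≥ 1 and R > 0 satisfy R^k > kβ. Then for every z > 0, 1/(βz^k + e^{−Rz}) ≤ β^{−1}·(kR)^k·(ln(R^k/(kβ)))^{−k}. -/
theorem core_aux (k u x : ℝ) (hk : 1 ≤ k) (hu : 0 < u) (hx : 0 < x) :
    u ^ k ≤ x ^ k + k * (Real.exp (k * u) * Real.exp (-x)) := by
  have h1 : 1 + k * (x / u - 1) ≤ (1 + (x / u - 1)) ^ k :=
    one_add_mul_self_le_rpow_one_add (by have := div_pos hx hu; linarith) hk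
  have h2 : (1 + (x / u - 1)) ^ k = x ^ k / u ^ k := by
    rw [add_sub_cancel, Real.div_rpow hx.le hu.le]
  have hp : 0 < u ^ k := Real.rpow_pos_of_pos hu k
  rw [h2, le_div_iff₀ hp] at h1
  have h3 : u ^ k = u ^ (k - 1) * u := by
    rw [Real.rpow_sub_one hu.ne']; field_simp
  have h4 : u ^ (k - 1) ≤ Real.exp (u * (k - 1)) := by
    rw [Real.exp_mul]
    exact Real.rpow_le_rpow hu.le (by linarith [Real.add_one_le_exp u]) (by linarith)
  have h5 : u - x ≤ Real.exp (u - x) := by linarith [Real.add_one_le_exp (u - x)]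
  have h6 : Real.exp (k * u) * Real.exp (-x) = Real.exp (u * (k - 1)) * Real.exp (u - x) := by
    rw [← Real.exp_add, ← Real.exp_add]; congr 1; ring
  have hq : 0 < u ^ (k - 1) := Real.rpow_pos_of_pos hu _
  have h7 : u ^ (k - 1) * (u - x) ≤ Real.exp (u * (k - 1)) * Real.exp (u - x) :=
    (mul_le_mul_of_nonneg_left h5 hq.le).trans
      (mul_le_mul_of_nonneg_right h4 (Real.exp_pos _).le)
  have h8 : (1 + k * (x / u - 1)) * u ^ k = u ^ k - k * (u ^ (k - 1) * (u - x)) := by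
    rw [h3]; field_simp; ring
  rw [h6]
  have h9 := mul_le_mul_of_nonneg_left h7 (by linarith : (0:ℝ) ≤ k)
  linarith

/-- Uniform bound for `g(z) = 1/(β z^k + e^{-Rz})`:
`g(z) ≤ β⁻¹ (kR)^k (ln(R^k/(kβ)))^{-k}` whenever `R^k > kβ`. -/
theorem stmt2 (β k R : ℝ) (hβ : 0 < β) (hk : 1 ≤ k) (hR : 0 < R)
    (h : k * β < R ^ k) :
    ∀ z : ℝ, 0 < z →
      1 / (β * z ^ k + Real.exp (-R * z)) ≤
        β⁻¹ * (k * R) ^ k * (Real.log (R ^ k / (k * β))) ^ (-k) := by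
  intro z hz
  have hk0 : 0 < k := by linarith
  have hkb : 0 < k * β := by positivity
  have hRk : 0 < R ^ k := Real.rpow_pos_of_pos hR k
  have hL : 0 < Real.log (R ^ k / (k * β)) := Real.log_pos ((one_lt_div hkb).2 h)
  have hE : Real.exp (Real.log (R ^ k / (k * β))) = R ^ k / (k * β) :=
    Real.exp_log (by positivity)
  generalize Real.log (R ^ k / (k * β)) = L at hL hE ⊢
  obtain ⟨u, rfl⟩ : ∃ u, L = k * u := ⟨L / k, by field_simp⟩
  have hu : 0 < u := pos_of_mul_pos_right hL hk0.le
  have hc := core_aux k u (R * z) hk hu (by positivity)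
  rw [hE, Real.mul_rpow hR.le hz.le] at hc
  have hup : 0 < u ^ k := Real.rpow_pos_of_pos hu k
  have hkp : 0 < k ^ k := Real.rpow_pos_of_pos hk0 k
  have hzp : 0 < z ^ k := Real.rpow_pos_of_pos hz k
  have hr : β⁻¹ * (k * R) ^ k * (k * u) ^ (-k) = R ^ k / (β * u ^ k) := by
    rw [Real.rpow_neg hL.le, Real.mul_rpow hk0.le hR.le, Real.mul_rpow hk0.le hu.le]
    field_simp
  rw [hr, neg_mul]
  have he := Real.exp_pos (-(R * z))
  generalize Real.exp (-(R * z)) = e at *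
  rw [div_le_div_iff₀ (by positivity) (by positivity)]
  have h2 : β * (R ^ k * z ^ k + k * (R ^ k / (k * β) * e)) = R ^ k * (β * z ^ k + e) := by
    field_simp
  have := mul_le_mul_of_nonneg_left hc hβ.le
  linarith
end

section
/- Let β > 0, k ≥ 1 and R > 0 satisfy R^k > kβ. Then for every z > 0 and every r with 0 ≤ r ≤ R, one has e^{−rz}/(βz^k + e^{−Rz}) ≤ (kR)^{k(1−r/R)} · β^{r/R−1} · (ln(R^k/(kβ)))^{k(r/R−1)}. -/
/-- Auxiliary scalar inequality. -/
theorem aux_ineq (k a w : ℝ) (hk : 1 ≤ k) (ha : 0 < a) (hw : 0 < w) :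
    a ^ k ≤ w ^ k + k * Real.exp (k * a - w) := by
  have hb := one_add_mul_self_le_rpow_one_add (s := w / a - 1) (p := k)
    (by have : 0 < w / a := by positivity
        linarith) hk
  have e1 : (1 + (w / a - 1)) = w / a := by ring
  rw [e1, Real.div_rpow hw.le ha.le] at hb
  have hak : 0 < a ^ k := by positivity
  rw [le_div_iff₀ hak] at hb
  have e2 : a ^ k = a ^ (k - 1) * a := by
    rw [← Real.rpow_add_one ha.ne']; congr 1; ring
  have h1 : a ^ (k - 1) ≤ Real.exp ((k - 1) * a) := by
    rw [mul_comm, Real.exp_mul]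
    exact Real.rpow_le_rpow ha.le (by linarith [Real.add_one_le_exp a]) (by linarith)
  have h2 : a - w ≤ Real.exp (a - w) := by linarith [Real.add_one_le_exp (a - w)]
  have h3 : a ^ (k - 1) * (a - w) ≤ Real.exp (k * a - w) := by
    have : Real.exp (k * a - w) = Real.exp ((k - 1) * a) * Real.exp (a - w) := by
      rw [← Real.exp_add]; congr 1; ring
    rw [this]
    calc a ^ (k - 1) * (a - w) ≤ a ^ (k - 1) * Real.exp (a - w) := by gcongr
      _ ≤ _ := by gcongr
  have e3 : (1 + k * (w / a - 1)) * a ^ k = a ^ k - k * (a ^ (k - 1) * (a - w)) := by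
    rw [e2]; field_simp; ring
  rw [e3] at hb
  nlinarith

/-- Inequality (2.9) of the paper: the weighted bound
`e^{-rz}/(β z^k + e^{-Rz}) ≤ (kR)^{k(1-r/R)} β^{r/R-1} (ln(R^k/(kβ)))^{k(r/R-1)}`. -/
theorem stmt3 (β k R : ℝ) (hβ : 0 < β) (hk : 1 ≤ k) (hR : 0 < R)
    (h : k * β < R ^ k) :
    ∀ z : ℝ, 0 < z → ∀ r : ℝ, 0 ≤ r → r ≤ R →
      Real.exp (-r * z) / (β * z ^ k + Real.exp (-R * z)) ≤
        (k * R) ^ (k * (1 - r / R)) * β ^ (r / R - 1) *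
          (Real.log (R ^ k / (k * β))) ^ (k * (r / R - 1)) := by
  intro z hz r hr hrR
  have hk0 : 0 < k := by linarith
  have hRk : 0 < R ^ k := by positivity
  have hu : 1 < R ^ k / (k * β) := by rw [lt_div_iff₀ (by positivity)]; linarith
  have hL := Real.log_pos hu
  have heL : Real.exp (Real.log (R ^ k / (k * β))) = R ^ k / (k * β) :=
    Real.exp_log (by linarith)
  set L := Real.log (R ^ k / (k * β)) with hLdef
  have hD : 0 < β * z ^ k + Real.exp (-R * z) := by positivity
  have key := aux_ineq k (L / k) (R * z) hk (by positivity) (by positivity)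
  have hm : β * (L / (k * R)) ^ k ≤ β * z ^ k + Real.exp (-R * z) := by
    have e1 : k * (L / k) - R * z = L + -R * z := by field_simp; ring
    rw [e1, Real.exp_add, heL, Real.mul_rpow hR.le hz.le] at key
    have e2 : L / (k * R) = (L / k) / R := by field_simp
    rw [e2, Real.div_rpow (by positivity) hR.le]
    have e3 : β * z ^ k + Real.exp (-R * z) = β * ((R ^ k * z ^ k +
        k * (R ^ k / (k * β) * Real.exp (-R * z))) / R ^ k) := by
      field_simp
    rw [e3]
    gcongr
  set D := β * z ^ k + Real.exp (-R * z) with hDdef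
  have hθ : r / R - 1 ≤ 0 := by
    have : r / R ≤ 1 := by rw [div_le_one hR]; exact hrR
    linarith
  have hnum : Real.exp (-r * z) ≤ D ^ (r / R) := by
    have : Real.exp (-r * z) = Real.exp (-R * z) ^ (r / R) := by
      rw [← Real.exp_mul]; congr 1; field_simp
    rw [this]
    apply Real.rpow_le_rpow (Real.exp_pos _).le _ (by positivity)
    have : 0 < β * z ^ k := by positivity
    linarith
  have hrhs : (k * R) ^ (k * (1 - r / R)) * β ^ (r / R - 1) * L ^ (k * (r / R - 1))
      = (β * (L / (k * R)) ^ k) ^ (r / R - 1) := by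
    rw [Real.mul_rpow hβ.le (by positivity), ← Real.rpow_mul (by positivity),
      Real.div_rpow hL.le (by positivity)]
    have : k * (1 - r / R) = -(k * (r / R - 1)) := by ring
    rw [this, Real.rpow_neg (by positivity)]
    ring
  rw [hrhs]
  calc Real.exp (-r * z) / D ≤ D ^ (r / R) / D := by gcongr
    _ = D ^ (r / R - 1) := by rw [Real.rpow_sub_one hD.ne']
    _ ≤ _ := Real.rpow_le_rpow_of_nonpos (by positivity) hm hθ
end

section
/- (Lemma 1) Let a > 0, k ≥ 1 and β > 0 satisfy a^k > kβ. Then for every α > 0, every λ > 0 and every x ∈ [0,a], the filtering function satisfies Ψ(β,x;α,λ) = e^{−√(αλ)(a−x)}/(2β(αλ)^{k/2} + 2e^{−√(αλ)a}) ≤ (1/2)·(ka)^{kx/a} · β^{−x/a} · (ln(a^k/(kβ)))^{−kx/a}. -/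
theorem aux_key (k s w : ℝ) (hk : 1 ≤ k) (hs : 0 < s) (hw : 0 < w) :
    s ^ k ≤ w ^ k + k * Real.exp (k * s - w) := by
  rcases le_total s w with hsw | hsw
  · have h1 : s ^ k ≤ w ^ k := Real.rpow_le_rpow hs.le hsw (by linarith)
    have h2 : 0 ≤ k * Real.exp (k * s - w) := by positivity
    linarith
  · have hb : 1 + k * (w / s - 1) ≤ (1 + (w / s - 1)) ^ k :=
      one_add_mul_self_le_rpow_one_add (by have : 0 < w / s := by positivity
                                           linarith) hk
    have h1 : (1 + (w / s - 1)) ^ k = w ^ k / s ^ k := by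
      rw [add_sub_cancel, Real.div_rpow hw.le hs.le]
    rw [h1, le_div_iff₀ (by positivity)] at hb
    have hsk : s ^ k = s ^ (k - 1) * s := by
      rw [← Real.rpow_add_one hs.ne']; congr 1; ring
    have h3 : (1 + k * (w / s - 1)) * s ^ k = s ^ k - k * (s ^ (k - 1) * (s - w)) := by
      rw [hsk]; field_simp; ring
    have h4 : s ^ (k - 1) ≤ Real.exp ((k - 1) * s) := by
      have : s ≤ Real.exp s := by linarith [Real.add_one_le_exp s]
      calc s ^ (k - 1) ≤ (Real.exp s) ^ (k - 1) :=
            Real.rpow_le_rpow hs.le this (by linarith)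
        _ = _ := by rw [← Real.exp_mul, mul_comm]
    have h5 : s - w ≤ Real.exp (s - w) := by linarith [Real.add_one_le_exp (s - w)]
    have h6 : s ^ (k - 1) * (s - w) ≤ Real.exp (k * s - w) := by
      calc _ ≤ Real.exp ((k - 1) * s) * Real.exp (s - w) :=
            mul_le_mul h4 h5 (by linarith) (Real.exp_pos _).le
        _ = _ := by rw [← Real.exp_add]; congr 1; ring
    have h7 := mul_le_mul_of_nonneg_left h6 (by linarith : 0 ≤ k)
    linarith

theorem aux_D (a k β z : ℝ) (ha : 0 < a) (hk : 1 ≤ k) (hβ : 0 < β)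
    (h : k * β < a ^ k) (hz : 0 < z) :
    β * (Real.log (a ^ k / (k * β)) / (k * a)) ^ k ≤ β * z ^ k + Real.exp (-z * a) := by
  have hk0 : 0 < k := by linarith
  have hkb : 0 < k * β := by positivity
  have hL : 0 < Real.log (a ^ k / (k * β)) :=
    Real.log_pos (by rw [one_lt_div hkb]; exact h)
  have hexp : Real.exp (Real.log (a ^ k / (k * β))) = a ^ k / (k * β) :=
    Real.exp_log (by positivity)
  set L := Real.log (a ^ k / (k * β)) with hLdef
  have key := aux_key k (L / k) (z * a) hk (by positivity) (by positivity)
  have e1 : k * (L / k) - z * a = L + (-z * a) := by field_simp; ring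
  rw [e1, Real.exp_add, hexp, Real.mul_rpow hz.le ha.le] at key
  have hak : 0 < a ^ k := by positivity
  have e2 : L / (k * a) = L / k / a := by field_simp
  rw [e2, Real.div_rpow (by positivity) ha.le]
  have := mul_le_mul_of_nonneg_left key (by positivity : 0 ≤ β / a ^ k)
  calc _ = β / a ^ k * (L / k) ^ k := by ring
    _ ≤ _ := this
    _ = _ := by field_simp

/-- Lemma 1: boundedness of the filtering function
`Ψ(β,x;α,λ) = e^{-√(αλ)(a-x)}/(2β(αλ)^{k/2} + 2e^{-√(αλ)a})
  ≤ (1/2)(ka)^{kx/a} β^{-x/a} (ln(a^k/(kβ)))^{-kx/a}`. -/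
theorem stmt4 (a k β : ℝ) (ha : 0 < a) (hk : 1 ≤ k) (hβ : 0 < β)
    (h : k * β < a ^ k) :
    ∀ α : ℝ, 0 < α → ∀ lam : ℝ, 0 < lam → ∀ x ∈ Set.Icc (0:ℝ) a,
      Real.exp (-Real.sqrt (α * lam) * (a - x)) /
          (2 * β * (α * lam) ^ (k / 2) + 2 * Real.exp (-Real.sqrt (α * lam) * a)) ≤
        (1 / 2) * (k * a) ^ (k * x / a) * β ^ (-(x / a)) *
          (Real.log (a ^ k / (k * β))) ^ (-(k * x / a)) := by
  intro α hα lam hlam x hx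
  obtain ⟨hx0, hxa⟩ := hx
  have hp : 0 < α * lam := by positivity
  have hz : 0 < Real.sqrt (α * lam) := Real.sqrt_pos.2 hp
  have hzk : (α * lam) ^ (k / 2) = Real.sqrt (α * lam) ^ k := by
    rw [Real.sqrt_eq_rpow, ← Real.rpow_mul hp.le]; congr 1; ring
  rw [hzk]
  have hD := aux_D a k β _ ha hk hβ h hz
  have hk0 : 0 < k := by linarith
  have hkb : 0 < k * β := by positivity
  have hL : 0 < Real.log (a ^ k / (k * β)) :=
    Real.log_pos (by rw [one_lt_div hkb]; exact h)
  set L := Real.log (a ^ k / (k * β))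
  set z := Real.sqrt (α * lam)
  set D := β * z ^ k + Real.exp (-z * a) with hDdef
  have hDpos : 0 < D := by positivity
  have hθ : 0 ≤ x / a := by positivity
  have hθ1 : x / a ≤ 1 := by rw [div_le_one ha]; exact hxa
  have h1 : Real.exp (-z * (a - x)) ≤ D ^ (1 - x / a) := by
    calc _ = (Real.exp (-z * a)) ^ (1 - x / a) := by
          rw [← Real.exp_mul]; congr 1; field_simp
      _ ≤ _ := Real.rpow_le_rpow (Real.exp_pos _).le
          (by rw [hDdef]; linarith [(by positivity : 0 ≤ β * z ^ k)]) (by linarith)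
  have h2 : D ^ (-(x / a)) ≤ (β * (L / (k * a)) ^ k) ^ (-(x / a)) :=
    Real.rpow_le_rpow_of_nonpos (by positivity) hD (by linarith)
  have h3 : (β * (L / (k * a)) ^ k) ^ (-(x / a))
      = (k * a) ^ (k * x / a) * β ^ (-(x / a)) * L ^ (-(k * x / a)) := by
    rw [Real.mul_rpow hβ.le (by positivity), ← Real.rpow_mul (by positivity),
      Real.div_rpow hL.le (by positivity)]
    have : k * -(x / a) = -(k * x / a) := by ring
    rw [this, Real.rpow_neg (by positivity : 0 ≤ k * a), div_inv_eq_mul]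
    ring
  have h4 : Real.exp (-z * (a - x)) / D ≤ D ^ (-(x / a)) := by
    rw [div_le_iff₀ hDpos, ← Real.rpow_add_one hDpos.ne']
    rwa [show -(x / a) + 1 = 1 - x / a by ring]
  have h5 : Real.exp (-z * (a - x)) / (2 * β * z ^ k + 2 * Real.exp (-z * a))
      = 1 / 2 * (Real.exp (-z * (a - x)) / D) := by
    have : 2 * β * z ^ k + 2 * Real.exp (-z * a) = 2 * D := by rw [hDdef]; ring
    rw [this]; field_simp
  rw [h5]
  have := h4.trans (h2.trans h3.le)
  linarith
end
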